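/- Let J : ℕ × ℕ → (0,∞) satisfy J(r,p) ≤ C·e^{−γ(2p+2)2^r} for some constants C, γ > 0 (exponentially decaying positive couplings). For the Thue–Morse Hamiltonian H_TM with terms J(r,p)·(X(i)+X(i+2^r))²·(X(i+(2p+1)2^r)+X(i+(2p+2)2^r))² over i ∈ ℤ, r ≥ 0, p ≥ 0, and for every ε > 0, the Thue–Morse ground state is unstable against the chemical potential −ε favoring two equal neighboring spins: there exist X ∈ G_TM and a local excitation Y ∼ X such that H_TM(Y|X) − ε·Σ_{i∈ℤ}(1[Y(i)=Y(i+1)] − 1[X(i)=X(i+1)]) < 0. -/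

import Mathlib

/-- `t(n) = (−1)^{s(n)}` where `s(n)` is the sum of binary digits of `n` (Thue–Morse). -/
def tmSign (n : ℕ) : ℤ := (-1) ^ ((Nat.digits 2 n).sum)

/-- The two-sided Thue–Morse configuration in `{+1,−1}^ℤ`:
`X_TM(n) = t(n)` for `n ≥ 0` and `X_TM(n) = X_TM(−n−1)` for `n < 0`. -/
def XTM : ℤ → ℤ := fun n => if 0 ≤ n then tmSign n.toNat else tmSign (-n - 1).toNat

/-- `G_TM`: the closure in the product topology of the shift orbit of `X_TM`. -/
def GTM : Set (ℤ → ℤ) := closure {Y | ∃ k : ℤ, Y = fun n => XTM (n - k)}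

/-- `Y` is a local excitation of `X`: they differ at finitely many sites. -/
def LocalExc (Y X : ℤ → ℤ) : Prop := {i : ℤ | Y i ≠ X i}.Finite

/-- The four-spin Thue–Morse energy term at `(i, r, p)`:
`(σ_i + σ_{i+2^r})² (σ_{i+(2p+1)2^r} + σ_{i+(2p+2)2^r})²`. -/
noncomputable def tmTerm (X : ℤ → ℤ) (q : ℤ × ℕ × ℕ) : ℝ :=
  ((X q.1 + X (q.1 + 2 ^ q.2.1) : ℤ) : ℝ) ^ 2 *
    ((X (q.1 + (2 * (q.2.2 : ℤ) + 1) * 2 ^ q.2.1)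
      + X (q.1 + (2 * (q.2.2 : ℤ) + 2) * 2 ^ q.2.1) : ℤ) : ℝ) ^ 2

/-- Relative Thue–Morse Hamiltonian
`H_TM(Y|X) = Σ_{i,r,p} J(r,p)[term_{i,r,p}(Y) − term_{i,r,p}(X)]`. -/
noncomputable def HRelTM (J : ℕ → ℕ → ℝ) (Y X : ℤ → ℤ) : ℝ :=
  ∑' q : ℤ × ℕ × ℕ, J q.2.1 q.2.2 * (tmTerm Y q - tmTerm X q)

/-- Difference of the numbers of neighboring pairs of equal spins,
`Σ_i (1[Y(i)=Y(i+1)] − 1[X(i)=X(i+1)])` (a finite sum for `Y ∼ X`). -/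
noncomputable def equalPairDiff (Y X : ℤ → ℤ) : ℝ :=
  ∑ᶠ i : ℤ, ((if Y i = Y (i + 1) then (1 : ℝ) else 0) -
    (if X i = X (i + 1) then (1 : ℝ) else 0))

section ThueMorse

lemma tmSign_bit (b n : ℕ) (hb : b < 2) : tmSign (2 * n + b) = (-1) ^ b * tmSign n := by
  unfold tmSign
  rcases Nat.eq_zero_or_pos (2 * n + b) with h | h
  · obtain ⟨rfl, rfl⟩ : n = 0 ∧ b = 0 := by omega
    simp
  · rw [Nat.digits_def' (by norm_num) h, List.sum_cons, pow_add]
    congr 2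
    · omega
    · rw [show (2 * n + b) / 2 = n by omega]

lemma tmSign_add_two_pow (r n : ℕ) (h : Even (n / 2 ^ r)) :
    tmSign (n + 2 ^ r) = -tmSign n := by
  induction r generalizing n with
  | zero =>
    obtain ⟨m, hm⟩ := h
    obtain rfl : n = 2 * m + 0 := by simp at hm; omega
    rw [pow_zero, tmSign_bit 0 m (by norm_num), add_zero, tmSign_bit 1 m (by norm_num)]
    simp
  | succ r ih =>
    have hb : n % 2 < 2 := Nat.mod_lt _ (by norm_num)
    have hn : n = 2 * (n / 2) + n % 2 := (Nat.div_add_mod n 2).symm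
    rw [pow_succ', ← Nat.div_div_eq_div_mul] at h
    have e : n + 2 ^ (r + 1) = 2 * (n / 2 + 2 ^ r) + n % 2 := by rw [pow_succ']; omega
    rw [e, tmSign_bit _ _ hb, ih _ h]
    conv_rhs => rw [hn, tmSign_bit _ _ hb]
    ring

lemma tmSign_four_pow_mul (k m : ℕ) : tmSign (4 ^ k * m) = tmSign m := by
  induction k with
  | zero => simp
  | succ k ih =>
    rw [show 4 ^ (k + 1) * m = 2 * (2 * (4 ^ k * m) + 0) + 0 by ring,
      tmSign_bit _ _ (by norm_num), tmSign_bit _ _ (by norm_num), ih]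
    simp

lemma tmSign_four_pow_mul_succ_sub_one (k m : ℕ) :
    tmSign (4 ^ k * (m + 1) - 1) = tmSign m := by
  induction k with
  | zero => simp
  | succ k ih =>
    have hpos : 0 < 4 ^ k * (m + 1) := by positivity
    have e : 4 ^ (k + 1) * (m + 1) - 1 = 2 * (2 * (4 ^ k * (m + 1) - 1) + 1) + 1 := by
      rw [pow_succ', mul_assoc]; omega
    rw [e, tmSign_bit _ _ (by norm_num), tmSign_bit _ _ (by norm_num), ih]
    simp

lemma XTM_natCast (n : ℕ) : XTM n = tmSign n := by simp [XTM]

lemma XTM_add_two_pow (r : ℕ) (i : ℤ) (h : Even (i / 2 ^ r)) : XTM (i + 2 ^ r) = -XTM i := by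
  have hpos : (0 : ℤ) < 2 ^ r := by positivity
  rcases le_or_gt 0 i with hi | hi
  · lift i to ℕ using hi
    have h' : Even (i / 2 ^ r) := by exact_mod_cast h
    have := tmSign_add_two_pow r i h'
    rw [← XTM_natCast, ← XTM_natCast] at this
    exact_mod_cast this
  · obtain ⟨m, hm⟩ := h
    have hdiv := Int.mul_ediv_add_emod i (2 ^ r)
    have h0 := Int.emod_nonneg i hpos.ne'
    have h1 := Int.emod_lt_of_pos i hpos
    rw [hm] at hdiv
    have hm0 : m < 0 := by
      by_contra! hc
      have := mul_nonneg hpos.le (add_nonneg hc hc)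
      omega
    have hlt : i + 2 ^ r < 0 := by nlinarith
    obtain ⟨n, hn⟩ := Int.eq_ofNat_of_zero_le (show 0 ≤ -(i + 2 ^ r) - 1 by omega)
    have hn' : -i - 1 = ((n + 2 ^ r : ℕ) : ℤ) := by push_cast; omega
    have heven : Even (n / 2 ^ r) := by
      have : ((n / 2 ^ r : ℕ) : ℤ) = (-m - 1) + (-m - 1) := by
        push_cast
        rw [← hn, Int.ediv_eq_iff_of_pos hpos]
        constructor <;> nlinarith
      exact (Int.even_coe_nat _).1 ⟨_, this⟩
    have := tmSign_add_two_pow r n heven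
    simp only [XTM, if_neg hlt.not_ge, if_neg hi.not_ge]
    rw [hn, hn', Int.toNat_natCast, Int.toNat_natCast, this, neg_neg]

lemma XTM_mem_GTM : XTM ∈ GTM := subset_closure ⟨0, by simp⟩

/-- A configuration whose spins at distance `2 ^ r` are opposite whenever the left one sits in an
even block of length `2 ^ r` has no energy at scale `r`. -/
lemma tmTerm_eq_zero {Z : ℤ → ℤ} {r : ℕ}
    (hZ : ∀ i : ℤ, Even (i / 2 ^ r) → Z (i + 2 ^ r) = -Z i) (i : ℤ) (p : ℕ) :
    tmTerm Z (i, r, p) = 0 := by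
  have hpos : (2 : ℤ) ^ r ≠ 0 := by positivity
  unfold tmTerm
  rcases Int.even_or_odd (i / 2 ^ r) with h | h
  · simp [hZ i h]
  · have h' : Even ((i + (2 * (p : ℤ) + 1) * 2 ^ r) / 2 ^ r) := by
      rw [Int.add_mul_ediv_right _ _ hpos]
      exact h.add_odd ⟨p, rfl⟩
    have := hZ _ h'
    rw [show i + (2 * (p : ℤ) + 1) * 2 ^ r + 2 ^ r = i + (2 * (p : ℤ) + 2) * 2 ^ r by ring] at this
    simp [this]

lemma tmTerm_XTM (q : ℤ × ℕ × ℕ) : tmTerm XTM q = 0 :=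
  tmTerm_eq_zero (XTM_add_two_pow q.2.1) q.1 q.2.2

lemma tmTerm_nonneg (Z : ℤ → ℤ) (q : ℤ × ℕ × ℕ) : 0 ≤ tmTerm Z q := by
  unfold tmTerm; positivity

/-- The configuration `X` with the spins in `[a, b)` reversed. -/
noncomputable def flipBlock (X : ℤ → ℤ) (a b : ℤ) : ℤ → ℤ := fun i => if i ∈ Finset.Ico a b then -X i else X i

lemma localExc_flipBlock (X : ℤ → ℤ) (a b : ℤ) : LocalExc (flipBlock X a b) X := by
  refine (Finset.Ico a b).finite_toSet.subset fun i hi => ?_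
  by_contra h
  exact hi (if_neg h)

lemma le_add_two_pow_iff {r : ℕ} {a i : ℤ} (ha : 2 ^ (r + 1) ∣ a) (hi : Even (i / 2 ^ r)) :
    a ≤ i + 2 ^ r ↔ a ≤ i := by
  have hpos : (0 : ℤ) < 2 ^ r := by positivity
  obtain ⟨c, rfl⟩ := ha
  obtain ⟨m, hm⟩ := hi
  rw [show (2 : ℤ) ^ (r + 1) * c = (2 * c) * 2 ^ r by ring, ← Int.le_ediv_iff_mul_le hpos,
    ← Int.le_ediv_iff_mul_le hpos, Int.add_ediv_of_dvd_right dvd_rfl, Int.ediv_self hpos.ne', hm]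
  omega

lemma flipBlock_XTM_add_two_pow {r : ℕ} {a b : ℤ} (ha : 2 ^ (r + 1) ∣ a) (hb : 2 ^ (r + 1) ∣ b)
    (i : ℤ) (hi : Even (i / 2 ^ r)) :
    flipBlock XTM a b (i + 2 ^ r) = -flipBlock XTM a b i := by
  have h : i + 2 ^ r ∈ Finset.Ico a b ↔ i ∈ Finset.Ico a b := by
    rw [Finset.mem_Ico, Finset.mem_Ico, le_add_two_pow_iff ha hi, ← not_le, ← not_le,
      le_add_two_pow_iff hb hi]
  simp only [flipBlock, h, XTM_add_two_pow r i hi]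
  split_ifs <;> rfl

lemma equalPairDiff_flipBlock {X : ℤ → ℤ} {a b : ℤ} (hab : a < b) (ha : X (a - 1) = -X a)
    (hb : X (b - 1) = -X b) (ha0 : X a ≠ 0) (hb0 : X b ≠ 0) :
    equalPairDiff (flipBlock X a b) X = 2 := by
  have hne : a - 1 ≠ b - 1 := by omega
  have key : ∀ i : ℤ, i ≠ a - 1 → i ≠ b - 1 →
      (flipBlock X a b i = flipBlock X a b (i + 1) ↔ X i = X (i + 1)) := by
    intro i h1 h2
    have : i + 1 ∈ Finset.Ico a b ↔ i ∈ Finset.Ico a b := by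
      simp only [Finset.mem_Ico]; omega
    simp only [flipBlock, this]
    split_ifs <;> simp
  unfold equalPairDiff
  rw [finsum_eq_sum_of_support_subset (s := {a - 1, b - 1})]
  · rw [Finset.sum_pair hne]
    have h1 : ¬ -X a = X a := by omega
    have h2 : ¬ -X b = X b := by omega
    have m1 : b - 1 ∈ Finset.Ico a b := by simp only [Finset.mem_Ico]; omega
    have m2 : b ∉ Finset.Ico a b := by simp
    have m3 : a - 1 ∉ Finset.Ico a b := by simp
    have m4 : a ∈ Finset.Ico a b := by simpa using hab
    simp only [sub_add_cancel, flipBlock, if_pos m1, if_neg m2, if_neg m3, if_pos m4, ha, hb,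
      if_neg h1, if_neg h2]
    norm_num
  · intro i hi
    by_contra h
    simp only [Finset.coe_insert, Finset.coe_singleton, Set.mem_insert_iff,
      Set.mem_singleton_iff, not_or] at h
    exact hi (by simp only [key i h.1 h.2, sub_self])

/-- The indicator of `[a, b)`, translated by `s`. -/
noncomputable def blockIndicator (a b s i : ℤ) : ℝ := if i + s ∈ Finset.Ico a b then 1 else 0

lemma blockIndicator_nonneg (a b s i : ℤ) : 0 ≤ blockIndicator a b s i := by
  unfold blockIndicator; split_ifs <;> norm_num

lemma hasSum_blockIndicator_mul {ι : Type*} {a b : ℤ} (hab : a ≤ b) (s : ι → ℤ) {h : ι → ℝ}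
    (h0 : ∀ x, 0 ≤ h x) {c : ℝ} (hc : HasSum h c) :
    HasSum (fun q : ℤ × ι => blockIndicator a b (s q.2) q.1 * h q.2) ((b - a) * c) := by
  have hind : HasSum (fun i : ℤ => blockIndicator a b 0 i) ((b : ℝ) - a) := by
    have := hasSum_sum_of_ne_finset_zero (L := .unconditional ℤ)
      (f := fun i : ℤ => blockIndicator a b 0 i) (s := Finset.Ico a b) (fun i hi => by simp only [blockIndicator, add_zero, if_neg hi])
    convert this using 1
    rw [Finset.sum_congr rfl (g := fun _ => (1 : ℝ))
      (fun i hi => by simp only [blockIndicator, add_zero, if_pos hi])]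
    rw [Finset.sum_const, Int.card_Ico, nsmul_one, ← Int.cast_natCast,
      Int.toNat_of_nonneg (by omega), Int.cast_sub]
  have hprod := hind.mul hc
    (hind.summable.mul_of_nonneg hc.summable (blockIndicator_nonneg a b 0) h0)
  let e : ℤ × ι ≃ ℤ × ι :=
    { toFun := fun q => (q.1 + s q.2, q.2)
      invFun := fun q => (q.1 - s q.2, q.2)
      left_inv := fun q => by simp
      right_inv := fun q => by simp }
  have hshift := e.hasSum_iff.2 hprod
  simpa [Function.comp_def, e, blockIndicator] using hshift

lemma XTM_eq_or (i : ℤ) : XTM i = 1 ∨ XTM i = -1 := by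
  unfold XTM tmSign
  split_ifs <;> exact neg_one_pow_eq_or _ _

lemma flipBlock_XTM_eq_or (a b i : ℤ) : flipBlock XTM a b i = 1 ∨ flipBlock XTM a b i = -1 := by
  unfold flipBlock
  have := XTM_eq_or i
  split_ifs <;> omega

lemma tmTerm_le_of_eq_or {Z : ℤ → ℤ} (hZ : ∀ i, Z i = 1 ∨ Z i = -1) (q : ℤ × ℕ × ℕ) :
    tmTerm Z q ≤ 16 := by
  have key : ∀ i j : ℤ, ((Z i + Z j : ℤ) : ℝ) ^ 2 ≤ 4 := by
    intro i j
    rcases hZ i with h | h <;> rcases hZ j with h' | h' <;> rw [h, h'] <;> norm_num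
  calc tmTerm Z q ≤ 4 * 4 := mul_le_mul (key _ _) (key _ _) (sq_nonneg _) (by norm_num)
    _ = 16 := by norm_num

lemma tmTerm_flipBlock_le (a b : ℤ) (q : ℤ × ℕ × ℕ) :
    tmTerm (flipBlock XTM a b) q ≤ 16 * (blockIndicator a b 0 q.1 +
      blockIndicator a b (2 ^ q.2.1) q.1 +
      blockIndicator a b ((2 * (q.2.2 : ℤ) + 1) * 2 ^ q.2.1) q.1 +
      blockIndicator a b ((2 * (q.2.2 : ℤ) + 2) * 2 ^ q.2.1) q.1) := by
  have hle := tmTerm_le_of_eq_or (flipBlock_XTM_eq_or a b) q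
  have h1 := blockIndicator_nonneg a b 0 q.1
  have h2 := blockIndicator_nonneg a b (2 ^ q.2.1) q.1
  have h3 := blockIndicator_nonneg a b ((2 * (q.2.2 : ℤ) + 1) * 2 ^ q.2.1) q.1
  have h4 := blockIndicator_nonneg a b ((2 * (q.2.2 : ℤ) + 2) * 2 ^ q.2.1) q.1
  have hone : ∀ s : ℤ, q.1 + s ∈ Finset.Ico a b → blockIndicator a b s q.1 = 1 :=
    fun s hs => if_pos hs
  by_cases m1 : q.1 + 0 ∈ Finset.Ico a b
  · linarith [hone _ m1]
  by_cases m2 : q.1 + 2 ^ q.2.1 ∈ Finset.Ico a b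
  · linarith [hone _ m2]
  by_cases m3 : q.1 + (2 * (q.2.2 : ℤ) + 1) * 2 ^ q.2.1 ∈ Finset.Ico a b
  · linarith [hone _ m3]
  by_cases m4 : q.1 + (2 * (q.2.2 : ℤ) + 2) * 2 ^ q.2.1 ∈ Finset.Ico a b
  · linarith [hone _ m4]
  rw [add_zero] at m1
  have : tmTerm (flipBlock XTM a b) q = tmTerm XTM q := by
    simp only [tmTerm, flipBlock, if_neg m1, if_neg m2, if_neg m3, if_neg m4]
  rw [this, tmTerm_XTM]
  positivity

lemma exp_decay_le {γ : ℝ} (hγ : 0 < γ) {R r : ℕ} (hr : R ≤ r) (p : ℕ) :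
    Real.exp (-γ * ((2 * (p : ℝ) + 2) * 2 ^ r)) ≤
      Real.exp (-γ * 2 ^ R) * (Real.exp (-γ) ^ r * Real.exp (-γ) ^ p) := by
  rw [← Real.exp_nat_mul, ← Real.exp_nat_mul, ← Real.exp_add, ← Real.exp_add, Real.exp_le_exp]
  have h1 : (2 : ℝ) ^ R ≤ 2 ^ r := pow_le_pow_right₀ (by norm_num) hr
  have h2 : (r : ℝ) + 1 ≤ 2 ^ r := by exact_mod_cast Nat.lt_two_pow_self (n := r)
  have h3 : (0 : ℝ) ≤ p := by positivity
  have h4 : (0 : ℝ) ≤ r := by positivity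
  have h5 : (2 : ℝ) ^ R + r + p ≤ (2 * (p : ℝ) + 2) * 2 ^ r := by nlinarith
  nlinarith

/-- Reversing a block aligned at scale `2 ^ R` only costs energy at scales `r ≥ R`. -/
lemma HRelTM_flipBlock_le {J : ℕ → ℕ → ℝ} (hJpos : ∀ r p, 0 < J r p) {C γ : ℝ} (hC : 0 < C)
    (hγ : 0 < γ) (hJ : ∀ r p : ℕ, J r p ≤ C * Real.exp (-γ * ((2 * (p : ℝ) + 2) * 2 ^ r)))
    {R : ℕ} {a b : ℤ} (hab : a ≤ b) (ha : 2 ^ R ∣ a) (hb : 2 ^ R ∣ b) :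
    HRelTM J (flipBlock XTM a b) XTM ≤
      64 * C * ((1 - Real.exp (-γ))⁻¹ ^ 2) * ((b - a) * Real.exp (-γ * 2 ^ R)) := by
  have hρ0 : 0 ≤ Real.exp (-γ) := (Real.exp_pos _).le
  have hρ1 : Real.exp (-γ) < 1 := Real.exp_lt_one_iff.2 (by linarith)
  have hgeom := hasSum_geometric_of_lt_one hρ0 hρ1
  set h : ℕ × ℕ → ℝ := fun x =>
    16 * C * Real.exp (-γ * 2 ^ R) * (Real.exp (-γ) ^ x.1 * Real.exp (-γ) ^ x.2) with hh
  have h0 : ∀ x, 0 ≤ h x := fun x => by positivity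
  have hsum := (hgeom.mul hgeom (hgeom.summable.mul_of_nonneg hgeom.summable
    (fun _ => by positivity) (fun _ => by positivity))).mul_left (16 * C * Real.exp (-γ * 2 ^ R))
  have hg' := (((hasSum_blockIndicator_mul hab (fun _ : ℕ × ℕ => 0) h0 hsum).add
    (hasSum_blockIndicator_mul hab (fun x : ℕ × ℕ => 2 ^ x.1) h0 hsum)).add
    (hasSum_blockIndicator_mul hab
      (fun x : ℕ × ℕ => (2 * (x.2 : ℤ) + 1) * 2 ^ x.1) h0 hsum)).add
    (hasSum_blockIndicator_mul hab
      (fun x : ℕ × ℕ => (2 * (x.2 : ℤ) + 2) * 2 ^ x.1) h0 hsum)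
  have hg : HasSum (fun q : ℤ × ℕ × ℕ => h q.2 * (blockIndicator a b 0 q.1 +
      blockIndicator a b (2 ^ q.2.1) q.1 +
      blockIndicator a b ((2 * (q.2.2 : ℤ) + 1) * 2 ^ q.2.1) q.1 +
      blockIndicator a b ((2 * (q.2.2 : ℤ) + 2) * 2 ^ q.2.1) q.1))
      (64 * C * ((1 - Real.exp (-γ))⁻¹ ^ 2) * ((b - a) * Real.exp (-γ * 2 ^ R))) := by
    convert hg' using 1
    · funext q; ring
    · ring
  have hf0 : ∀ q : ℤ × ℕ × ℕ,
      0 ≤ J q.2.1 q.2.2 * (tmTerm (flipBlock XTM a b) q - tmTerm XTM q) := fun q => by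
    rw [tmTerm_XTM, sub_zero]
    exact mul_nonneg (hJpos _ _).le (tmTerm_nonneg _ _)
  have hfg : ∀ q : ℤ × ℕ × ℕ,
      J q.2.1 q.2.2 * (tmTerm (flipBlock XTM a b) q - tmTerm XTM q) ≤
      h q.2 * (blockIndicator a b 0 q.1 + blockIndicator a b (2 ^ q.2.1) q.1 +
      blockIndicator a b ((2 * (q.2.2 : ℤ) + 1) * 2 ^ q.2.1) q.1 +
      blockIndicator a b ((2 * (q.2.2 : ℤ) + 2) * 2 ^ q.2.1) q.1) := fun q => by
    have hnn := add_nonneg (add_nonneg (add_nonneg (blockIndicator_nonneg a b 0 q.1)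
      (blockIndicator_nonneg a b (2 ^ q.2.1) q.1))
      (blockIndicator_nonneg a b ((2 * (q.2.2 : ℤ) + 1) * 2 ^ q.2.1) q.1))
      (blockIndicator_nonneg a b ((2 * (q.2.2 : ℤ) + 2) * 2 ^ q.2.1) q.1)
    rw [tmTerm_XTM, sub_zero]
    rcases lt_or_ge q.2.1 R with hr | hr
    · have hd : (2 : ℤ) ^ (q.2.1 + 1) ∣ 2 ^ R := pow_dvd_pow _ hr
      have hz : tmTerm (flipBlock XTM a b) q = 0 :=
        tmTerm_eq_zero (flipBlock_XTM_add_two_pow (hd.trans ha) (hd.trans hb)) q.1 q.2.2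
      rw [hz, mul_zero]
      exact mul_nonneg (h0 _) hnn
    · have hJ' : J q.2.1 q.2.2 * 16 ≤ h q.2 := by
        have := mul_le_mul_of_nonneg_left (exp_decay_le hγ hr q.2.2) hC.le
        simp only [hh]
        linarith [hJ q.2.1 q.2.2]
      calc _ ≤ J q.2.1 q.2.2 * (16 * _) :=
            mul_le_mul_of_nonneg_left (tmTerm_flipBlock_le a b q) (hJpos _ _).le
        _ = (J q.2.1 q.2.2 * 16) * _ := (mul_assoc _ _ _).symm
        _ ≤ _ := mul_le_mul_of_nonneg_right hJ' hnn
  exact ((Summable.of_nonneg_of_le hf0 hfg hg.summable).tsum_le_tsum hfg hg.summable).trans_eq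
    hg.tsum_eq

end ThueMorse

/-- For exponentially decaying positive couplings
`J(r,p) ≤ C·exp(−γ(2p+2)2^r)`, the Thue–Morse ground state is unstable against an arbitrarily
small chemical potential favoring two equal neighboring spins: for every `ε > 0` there are
`X ∈ G_TM` and a local excitation `Y ∼ X` with
`H_TM(Y|X) − ε·Σ_i (1[Y(i)=Y(i+1)] − 1[X(i)=X(i+1)]) < 0`. -/
theorem thueMorse_unstable_against_chemical_potential
    (J : ℕ → ℕ → ℝ) (hJpos : ∀ r p, 0 < J r p)
    (hJdecay : ∃ C : ℝ, 0 < C ∧ ∃ γ : ℝ, 0 < γ ∧ ∀ r p : ℕ,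
      J r p ≤ C * Real.exp (-γ * ((2 * (p : ℝ) + 2) * 2 ^ r))) :
    ∀ ε : ℝ, 0 < ε → ∃ X ∈ GTM, ∃ Y : ℤ → ℤ, LocalExc Y X ∧
      HRelTM J Y X - ε * equalPairDiff Y X < 0 := by
  intro ε hε
  obtain ⟨C, hC, γ, hγ, hJ⟩ := hJdecay
  have hlim : Filter.Tendsto (fun k : ℕ => 64 * C * ((1 - Real.exp (-γ))⁻¹ ^ 2) *
      ((4 : ℝ) ^ k * Real.exp (-γ * 4 ^ k))) Filter.atTop (nhds 0) := by
    have h := (Real.tendsto_pow_mul_exp_neg_atTop_nhds_zero 1).comp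
      ((tendsto_pow_atTop_atTop_of_one_lt (r := (4 : ℝ)) (by norm_num)).const_mul_atTop hγ)
    have h' := h.const_mul (64 * C * ((1 - Real.exp (-γ))⁻¹ ^ 2) * γ⁻¹)
    rw [mul_zero] at h'
    refine h'.congr fun k => ?_
    simp only [Function.comp_apply, pow_one, neg_mul]
    field_simp
  obtain ⟨k, hk⟩ := (hlim.eventually_lt_const (show (0 : ℝ) < 2 * ε by positivity)).exists
  have hpow : (2 : ℤ) ^ (2 * k) = 4 ^ k := by rw [pow_mul]; norm_num
  have hpowR : (2 : ℝ) ^ (2 * k) = 4 ^ k := by rw [pow_mul]; norm_num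
  have hpos : (0 : ℤ) < 4 ^ k := by positivity
  have hval : ∀ m : ℕ, XTM (4 ^ k * m) = tmSign m := fun m => by
    rw [← tmSign_four_pow_mul k m, ← XTM_natCast]; push_cast; rfl
  have hval' : ∀ m : ℕ, XTM (4 ^ k * (m + 1) - 1) = tmSign m := fun m => by
    rw [← tmSign_four_pow_mul_succ_sub_one k m, ← XTM_natCast,
      Nat.cast_sub (Nat.one_le_iff_ne_zero.2 (by positivity))]
    push_cast; rfl
  have t3 : tmSign 3 = 1 := by norm_num [tmSign]
  have t4 : tmSign 4 = -1 := by norm_num [tmSign]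
  have t5 : tmSign 5 = 1 := by norm_num [tmSign]
  have v4 : XTM (4 ^ k * 4) = -1 := by simpa [t4] using hval 4
  have v5 : XTM (4 ^ k * 5) = 1 := by simpa [t5] using hval 5
  have v4' : XTM (4 ^ k * 4 - 1) = 1 := by simpa [t3] using hval' 3
  have v5' : XTM (4 ^ k * 5 - 1) = -1 := by simpa [t4] using hval' 4
  refine ⟨XTM, XTM_mem_GTM, flipBlock XTM (4 ^ k * 4) (4 ^ k * 5),
    localExc_flipBlock _ _ _, ?_⟩
  rw [equalPairDiff_flipBlock (by omega) (by rw [v4, v4']; rfl) (by rw [v5, v5'])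
    (by rw [v4]; norm_num) (by rw [v5]; norm_num)]
  have hH := HRelTM_flipBlock_le hJpos hC hγ hJ (R := 2 * k) (a := 4 ^ k * 4) (b := 4 ^ k * 5)
    (by omega) (hpow ▸ dvd_mul_right _ _) (hpow ▸ dvd_mul_right _ _)
  rw [hpowR] at hH
  push_cast at hH
  rw [show (4 : ℝ) ^ k * 5 - 4 ^ k * 4 = 4 ^ k by ring] at hH
  linarith
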